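/- Let d ≥ 2 and let I = [0,2] × [0,1]^{d−1}. For the cube partition Ω_| = (Ω_{1,|}, Ω_{2,|}) of I with Ω_{1,|} = [0,1]^d and Ω_{2,|} = [1,2] × [0,1]^{d−1}, the stratified sample satisfies 8 · E L2²(P_{Ω_|}) = 4·2^{−d} − 5·3^{−d}. -/

import Mathlib

open MeasureTheory ProbabilityTheory

noncomputable section

namespace StratifiedSampling

variable {d : ℕ} {ι : Type} [Fintype ι]

/-- Lebesgue volume of a subset of `ℝ^d` as a real number. -/
def vol (s : Set (Fin d → ℝ)) : ℝ := (volume s).toReal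

/-- Number of points of the configuration `p` that lie in the lower box `(-∞, x]`. -/
def countIn (p : ι → (Fin d → ℝ)) (x : Fin d → ℝ) : ℝ :=
  ∑ i, Set.indicator (Set.Iic x) (fun _ => (1 : ℝ)) (p i)

/-- Discrepancy function of the point configuration `p` in the set `K`:
`d_P(x) = #(P ∩ (-∞,x])/N − |K ∩ (-∞,x]|/|K|`. -/
def discrep (K : Set (Fin d → ℝ)) (p : ι → (Fin d → ℝ)) (x : Fin d → ℝ) : ℝ :=
  countIn p x / (Fintype.card ι : ℝ) - vol (K ∩ Set.Iic x) / vol K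

/-- Joint distribution of the stratified sample associated with the family `Ω`:
the points are independent and the `i`-th point is uniformly distributed on `Ω i`. -/
def stratDist (Ω : ι → Set (Fin d → ℝ)) : Measure (ι → (Fin d → ℝ)) :=
  Measure.pi fun i => ProbabilityTheory.cond volume (Ω i)

/-- Mean squared `L2`-discrepancy of the stratified sample from the family `Ω` in `K`:
`E L2²(P_Ω) = E[(1/|K|) ∫_K d_{P_Ω}(x)² dx]`. -/
def meanL2sq (K : Set (Fin d → ℝ)) (Ω : ι → Set (Fin d → ℝ)) : ℝ :=
  ∫ p, ((1 / vol K) * ∫ x in K, (discrep K p x) ^ 2) ∂(stratDist Ω)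

/-- `Ω` is a partition of `K`: measurable sets of positive volume whose union
is `K` and whose distinct members have disjoint interiors. -/
structure IsPartition (K : Set (Fin d → ℝ)) (Ω : ι → Set (Fin d → ℝ)) : Prop where
  measurableSet : ∀ i, MeasurableSet (Ω i)
  vol_pos : ∀ i, 0 < volume (Ω i)
  iUnion_eq : (⋃ i, Ω i) = K
  disjoint_interiors : ∀ i j, i ≠ j → interior (Ω i) ∩ interior (Ω j) = ∅

/-- All members of `Ω` have the same volume. -/
def IsEquivolume (Ω : ι → Set (Fin d → ℝ)) : Prop :=
  ∀ i j, volume (Ω i) = volume (Ω j)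

/-- `q_i(x) = |Ω_i ∩ (-∞,x]| / |Ω_i|`. -/
def qfun (Ω : ι → Set (Fin d → ℝ)) (i : ι) (x : Fin d → ℝ) : ℝ :=
  vol (Ω i ∩ Set.Iic x) / vol (Ω i)

end StratifiedSampling

namespace StratifiedSampling

/-- The box `I = [0,2] × [0,1]^{d−1}`. -/
def boxI (d : ℕ) : Set (Fin d → ℝ) :=
  Set.Icc 0 (fun k => if (k : ℕ) = 0 then 2 else 1)

/-- The left unit cube `[0,1]^d`. -/
def cubeLeft (d : ℕ) : Set (Fin d → ℝ) := Set.Icc 0 1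

/-- The right unit cube `[1,2] × [0,1]^{d−1}`. -/
def cubeRight (d : ℕ) : Set (Fin d → ℝ) :=
  Set.Icc (fun k => if (k : ℕ) = 0 then 1 else 0)
    (fun k => if (k : ℕ) = 0 then 2 else 1)

section MeanSquare

variable {d : ℕ} {ι : Type} [Fintype ι]

/-- The uniform distribution on `s` gives the lower box at `x` the mass `|s ∩ (-∞, x]| / |s|`. -/
lemma cond_real_Iic (s : Set (Fin d → ℝ)) (x : Fin d → ℝ) :
    (cond volume s).real (Set.Iic x) = vol (s ∩ Set.Iic x) / vol s := by
  simp [vol, Measure.real, cond_apply' measurableSet_Iic, ENNReal.toReal_mul, ENNReal.toReal_inv,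
    div_eq_inv_mul]

lemma variance_indicator_one {α : Type*} [MeasurableSpace α] (μ : Measure α)
    [IsProbabilityMeasure μ] {s : Set α} (hs : MeasurableSet s) :
    Var[s.indicator (fun _ => (1 : ℝ)); μ] = μ.real s * (1 - μ.real s) := by
  have hsq : (s.indicator (fun _ => (1 : ℝ))) ^ 2 = s.indicator (fun _ => (1 : ℝ)) := by
    ext a
    by_cases ha : a ∈ s <;> simp [ha]
  rw [variance_eq_sub ((memLp_const 1).indicator hs), hsq]
  simp only [integral_indicator hs, integral_const, smul_eq_mul, mul_one,
    measureReal_restrict_apply_univ]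
  ring

/-- The mean square of the discrepancy of a stratified sample at a point where the sample is
unbiased. -/
lemma integral_discrep_sq (K : Set (Fin d → ℝ)) (Ω : ι → Set (Fin d → ℝ))
    [∀ i, IsProbabilityMeasure (cond (volume : Measure (Fin d → ℝ)) (Ω i))] (x : Fin d → ℝ)
    (h : vol (K ∩ Set.Iic x) / vol K = (∑ i, qfun Ω i x) / Fintype.card ι) :
    ∫ p, discrep K p x ^ 2 ∂(stratDist Ω) =
      (∑ i, qfun Ω i x * (1 - qfun Ω i x)) / (Fintype.card ι : ℝ) ^ 2 := by
  set X : Π i : ι, (Fin d → ℝ) → ℝ := fun _ => (Set.Iic x).indicator fun _ => (1 : ℝ)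
  have hXm (i : ι) : Measurable (X i) := measurable_const.indicator measurableSet_Iic
  have hX (i : ι) : MemLp (X i) 2 (cond volume (Ω i)) :=
    (memLp_const 1).indicator measurableSet_Iic
  have hmean (i : ι) : ∫ a, X i a ∂(cond volume (Ω i)) = qfun Ω i x := by
    simp [X, integral_indicator measurableSet_Iic, cond_real_Iic, qfun]
  have hcount : ∫ p, (∑ i, fun p : ι → (Fin d → ℝ) => X i (p i)) p ∂(stratDist Ω)
      = ∑ i, qfun Ω i x := by
    simp only [Finset.sum_apply]
    unfold stratDist
    rw [integral_finsetSum]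
    · exact Finset.sum_congr rfl fun i _ => by
        rw [integral_comp_eval (hXm i).aestronglyMeasurable, hmean]
    · exact fun i _ => integrable_comp_eval ((hX i).integrable one_le_two)
  have hvar := variance_sum_pi hX
  have hsum : Measurable (∑ i, fun p : ι → (Fin d → ℝ) => X i (p i)) := by
    rw [Finset.sum_fn]
    exact Finset.measurable_sum _ fun i _ => (hXm i).comp (measurable_pi_apply i)
  rw [← stratDist, variance_eq_integral hsum.aemeasurable, hcount] at hvar
  simp only [X, variance_indicator_one _ measurableSet_Iic, cond_real_Iic] at hvar
  change _ = ∑ i, qfun Ω i x * (1 - qfun Ω i x) at hvar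
  rw [← hvar, ← integral_div]
  refine integral_congr_ae (.of_forall fun p => ?_)
  simp only [discrep, countIn, h, ← sub_div, div_pow, Finset.sum_apply]

lemma measurable_vol_inter_Iic {s : Set (Fin d → ℝ)} (hs : MeasurableSet s) :
    Measurable fun x => vol (s ∩ Set.Iic x) := by
  have hle : MeasurableSet {z : (Fin d → ℝ) × (Fin d → ℝ) | z.2 ∈ s ∧ z.2 ≤ z.1} :=
    (measurable_snd hs).inter (measurableSet_le measurable_snd measurable_fst)
  exact (measurable_measure_prodMk_left hle).ennreal_toReal

lemma measurable_discrep {K : Set (Fin d → ℝ)} (hK : MeasurableSet K) :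
    Measurable fun z : (ι → (Fin d → ℝ)) × (Fin d → ℝ) => discrep K z.1 z.2 := by
  have hcount : Measurable fun z : (ι → (Fin d → ℝ)) × (Fin d → ℝ) => countIn z.1 z.2 := by
    refine Finset.measurable_sum _ fun i _ => ?_
    have hle : MeasurableSet {z : (ι → (Fin d → ℝ)) × (Fin d → ℝ) | z.1 i ≤ z.2} :=
      measurableSet_le (by fun_prop) measurable_snd
    exact measurable_const.indicator hle
  exact (hcount.div_const _).sub
    (((measurable_vol_inter_Iic hK).comp measurable_snd).div_const _)

lemma abs_discrep_le_one {K : Set (Fin d → ℝ)} (hK : volume K ≠ ⊤)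
    (p : ι → (Fin d → ℝ)) (x : Fin d → ℝ) : |discrep K p x| ≤ 1 := by
  have hcount : 0 ≤ countIn p x / (Fintype.card ι : ℝ) ∧
      countIn p x / (Fintype.card ι : ℝ) ≤ 1 := by
    refine ⟨div_nonneg (Finset.sum_nonneg fun i _ => ?_) (Nat.cast_nonneg _),
      div_le_one_of_le₀ ?_ (Nat.cast_nonneg _)⟩
    · exact Set.indicator_nonneg (fun _ _ => zero_le_one) _
    · refine (Finset.sum_le_card_nsmul _ _ 1 fun i _ => ?_).trans (by simp)
      exact Set.indicator_le_self' (fun _ _ => zero_le_one) _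
  have hvol : 0 ≤ vol (K ∩ Set.Iic x) / vol K ∧ vol (K ∩ Set.Iic x) / vol K ≤ 1 :=
    ⟨div_nonneg ENNReal.toReal_nonneg ENNReal.toReal_nonneg,
      div_le_one_of_le₀ (ENNReal.toReal_mono hK (measure_mono Set.inter_subset_left))
        ENNReal.toReal_nonneg⟩
  rw [discrep, abs_le]
  constructor <;> linarith [hcount.1, hcount.2, hvol.1, hvol.2]

/-- The mean squared `L2`-discrepancy of an unbiased stratified sample. -/
lemma meanL2sq_eq {K : Set (Fin d → ℝ)} (hKm : MeasurableSet K) (hK : volume K ≠ ⊤)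
    (Ω : ι → Set (Fin d → ℝ)) (hpos : ∀ i, volume (Ω i) ≠ 0) (hfin : ∀ i, volume (Ω i) ≠ ⊤)
    (h : ∀ x, vol (K ∩ Set.Iic x) / vol K = (∑ i, qfun Ω i x) / Fintype.card ι) :
    meanL2sq K Ω = 1 / vol K *
      ((∫ x in K, ∑ i, qfun Ω i x * (1 - qfun Ω i x)) / (Fintype.card ι : ℝ) ^ 2) := by
  have hprob (i : ι) : IsProbabilityMeasure (cond (volume : Measure (Fin d → ℝ)) (Ω i)) :=
    cond_isProbabilityMeasure_of_finite (hpos i) (hfin i)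
  have : IsProbabilityMeasure (stratDist Ω) := by unfold stratDist; infer_instance
  have : IsFiniteMeasure (volume.restrict K) := isFiniteMeasure_restrict.2 hK
  have hint : Integrable (Function.uncurry fun (p : ι → (Fin d → ℝ)) x => discrep K p x ^ 2)
      ((stratDist Ω).prod (volume.restrict K)) := by
    refine Integrable.of_bound ((measurable_discrep hKm).pow_const 2).aestronglyMeasurable 1
      (.of_forall fun z => ?_)
    simpa [Function.uncurry] using abs_discrep_le_one hK z.1 z.2
  rw [meanL2sq, integral_const_mul, integral_integral_swap hint, ← integral_div]
  simp only [integral_discrep_sq K Ω _ (h _)]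

/-- Volume of the part of a box below `x`. -/
lemma vol_Icc_inter_Iic (a b x : Fin d → ℝ) :
    vol (Set.Icc a b ∩ Set.Iic x) = ∏ k, max (min (b k) (x k) - a k) 0 := by
  have h : Set.Icc a b ∩ Set.Iic x = Set.Icc a (b ⊓ x) := by
    ext y
    simp only [Set.mem_inter_iff, Set.mem_Icc, Set.mem_Iic, le_inf_iff, and_assoc]
  rw [h, vol, Real.volume_Icc_pi, ENNReal.toReal_prod]
  rfl

lemma setIntegral_Icc_prod (a b : Fin d → ℝ) (f : Fin d → ℝ → ℝ) :
    ∫ x in Set.Icc a b, ∏ k, f k (x k) = ∏ k, ∫ t in Set.Icc (a k) (b k), f k t := by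
  rw [← Set.pi_univ_Icc, volume_pi, Measure.restrict_pi_pi, integral_fintype_prod_eq_prod]

end MeanSquare

lemma setIntegral_Icc_clamp_pow (l : ℝ) (m : ℕ) :
    ∫ t in Set.Icc l (l + 1), max (min (l + 1) t - l) 0 ^ m = 1 / (m + 1) := by
  have h : ∀ t ∈ Set.Icc l (l + 1), max (min (l + 1) t - l) 0 ^ m = (t - l) ^ m := by
    rintro t ⟨h₁, h₂⟩
    rw [min_eq_right h₂, max_eq_left (sub_nonneg.2 h₁)]
  rw [setIntegral_congr_fun measurableSet_Icc h, integral_Icc_eq_integral_Ioc,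
    ← intervalIntegral.integral_of_le (by linarith),
    intervalIntegral.integral_comp_sub_right (fun t => t ^ m), integral_pow]
  simp

lemma setIntegral_Icc_zero_two {f : ℝ → ℝ} (hf : Continuous f) :
    ∫ t in Set.Icc 0 2, f t = (∫ t in Set.Icc 0 1, f t) + ∫ t in Set.Icc 1 2, f t := by
  simp only [integral_Icc_eq_integral_Ioc]
  rw [← intervalIntegral.integral_of_le zero_le_two, ← intervalIntegral.integral_of_le zero_le_one,
    ← intervalIntegral.integral_of_le one_le_two,
    intervalIntegral.integral_add_adjacent_intervals] <;> exact hf.intervalIntegrable _ _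

lemma setIntegral_clamp_zero_one_pow (m : ℕ) :
    ∫ t in Set.Icc (0 : ℝ) 1, max (min 1 t) 0 ^ m = 1 / (m + 1) := by
  simpa using setIntegral_Icc_clamp_pow 0 m

lemma setIntegral_clamp_left_pow (m : ℕ) :
    ∫ t in Set.Icc (0 : ℝ) 2, max (min 1 t) 0 ^ m = 1 / (m + 1) + 1 := by
  rw [setIntegral_Icc_zero_two (by fun_prop), setIntegral_clamp_zero_one_pow]
  have h : ∀ t ∈ Set.Icc (1 : ℝ) 2, max (min 1 t) 0 ^ m = 1 := fun t ht => by
    simp [min_eq_left ht.1]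
  rw [setIntegral_congr_fun measurableSet_Icc h]
  norm_num

lemma setIntegral_clamp_right_pow {m : ℕ} (hm : m ≠ 0) :
    ∫ t in Set.Icc (0 : ℝ) 2, max (min 2 t - 1) 0 ^ m = 1 / (m + 1) := by
  have h : ∀ t ∈ Set.Icc (0 : ℝ) 1, max (min 2 t - 1) 0 ^ m = 0 := fun t ht => by
    rw [max_eq_right (by linarith [min_le_right 2 t, ht.2]), zero_pow hm]
  have h₁ := setIntegral_Icc_clamp_pow 1 m
  norm_num at h₁
  rw [setIntegral_Icc_zero_two (by fun_prop), setIntegral_congr_fun measurableSet_Icc h]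
  simp [h₁]

lemma vol_boxI (n : ℕ) : vol (boxI (n + 1)) = 2 := by
  simp [vol, boxI, Real.volume_Icc_pi, Fin.prod_univ_succ]

lemma vol_cubeLeft (d : ℕ) : vol (cubeLeft d) = 1 := by
  simp [vol, cubeLeft, Real.volume_Icc_pi]

lemma vol_cubeRight (n : ℕ) : vol (cubeRight (n + 1)) = 1 := by
  norm_num [vol, cubeRight, Real.volume_Icc_pi, Fin.prod_univ_succ]

lemma vol_boxI_inter_Iic (n : ℕ) (x : Fin (n + 1) → ℝ) :
    vol (boxI (n + 1) ∩ Set.Iic x) =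
      max (min 2 (x 0)) 0 * ∏ j : Fin n, max (min 1 (x j.succ)) 0 := by
  simp [boxI, vol_Icc_inter_Iic, Fin.prod_univ_succ]

lemma vol_cubeLeft_inter_Iic (n : ℕ) (x : Fin (n + 1) → ℝ) :
    vol (cubeLeft (n + 1) ∩ Set.Iic x) =
      max (min 1 (x 0)) 0 * ∏ j : Fin n, max (min 1 (x j.succ)) 0 := by
  simp [cubeLeft, vol_Icc_inter_Iic, Fin.prod_univ_succ]

lemma vol_cubeRight_inter_Iic (n : ℕ) (x : Fin (n + 1) → ℝ) :
    vol (cubeRight (n + 1) ∩ Set.Iic x) =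
      max (min 2 (x 0) - 1) 0 * ∏ j : Fin n, max (min 1 (x j.succ)) 0 := by
  simp [cubeRight, vol_Icc_inter_Iic, Fin.prod_univ_succ]

lemma setIntegral_boxI_mul_prod (n : ℕ) (f g : ℝ → ℝ) :
    ∫ x in boxI (n + 1), f (x 0) * ∏ j : Fin n, g (x j.succ) =
      (∫ t in Set.Icc 0 2, f t) * (∫ t in Set.Icc 0 1, g t) ^ n := by
  have h := setIntegral_Icc_prod (0 : Fin (n + 1) → ℝ) (fun k => if (k : ℕ) = 0 then 2 else 1)
    (Fin.cons f fun _ => g)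
  simpa [boxI, Fin.prod_univ_succ] using h

lemma setIntegral_boxI_mul_one_sub (n : ℕ) {f : ℝ → ℝ} (hf : Continuous f) :
    ∫ x in boxI (n + 1), (f (x 0) * ∏ j : Fin n, max (min 1 (x j.succ)) 0) *
        (1 - f (x 0) * ∏ j : Fin n, max (min 1 (x j.succ)) 0) =
      (∫ t in Set.Icc 0 2, f t ^ 1) * (1 / 2) ^ n -
        (∫ t in Set.Icc 0 2, f t ^ 2) * (1 / 3) ^ n := by
  have hint (m : ℕ) : Integrable (fun x : Fin (n + 1) → ℝ =>
      f (x 0) ^ m * ∏ j : Fin n, max (min 1 (x j.succ)) 0 ^ m)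
      (volume.restrict (boxI (n + 1))) :=
    (by fun_prop : Continuous _).continuousOn.integrableOn_compact isCompact_Icc
  have hpow (m : ℕ) : ∫ x in boxI (n + 1),
      f (x 0) ^ m * ∏ j : Fin n, max (min 1 (x j.succ)) 0 ^ m =
        (∫ t in Set.Icc 0 2, f t ^ m) * (1 / (m + 1)) ^ n := by
    rw [setIntegral_boxI_mul_prod n (fun t => f t ^ m) (fun t => max (min 1 t) 0 ^ m),
      setIntegral_clamp_zero_one_pow]
  have h := integral_sub (hint 1) (hint 2)
  rw [hpow, hpow] at h
  norm_num only [Nat.cast_one, Nat.cast_ofNat] at h ⊢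
  rw [← h]
  congr! 2 with x
  simp only [Finset.prod_pow]
  ring

lemma clamp_add_clamp (t : ℝ) :
    max (min 1 t) 0 + max (min 2 t - 1) 0 = max (min 2 t) 0 := by
  grind

/-- For `d ≥ 2` and the cube partition of `I = [0,2] × [0,1]^{d−1}` into `[0,1]^d`
and `[1,2] × [0,1]^{d−1}`, one has `8 · E L2²(P_{Ω_|}) = 4·2^{−d} − 5·3^{−d}`. -/
theorem eight_meanL2sq_cube_partition (d : ℕ) (hd : 2 ≤ d) :
    8 * meanL2sq (boxI d) ![cubeLeft d, cubeRight d] =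
      4 * ((2 : ℝ) ^ d)⁻¹ - 5 * ((3 : ℝ) ^ d)⁻¹ := by
  obtain ⟨n, rfl⟩ := Nat.exists_eq_succ_of_ne_zero (by omega : d ≠ 0)
  set Ω := ![cubeLeft (n + 1), cubeRight (n + 1)] with hΩ
  have hone (i : Fin 2) : vol (Ω i) = 1 := by
    fin_cases i <;> simp [hΩ, vol_cubeLeft, vol_cubeRight]
  have hvol (i : Fin 2) : volume (Ω i) = 1 := (ENNReal.toReal_eq_one_iff _).1 (hone i)
  have hq (i : Fin 2) (x : Fin (n + 1) → ℝ) : qfun Ω i x = vol (Ω i ∩ Set.Iic x) := by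
    rw [qfun, hone, div_one]
  have hΩ₀ (x : Fin (n + 1) → ℝ) : qfun Ω 0 x =
      max (min 1 (x 0)) 0 * ∏ j : Fin n, max (min 1 (x j.succ)) 0 :=
    (hq 0 x).trans (vol_cubeLeft_inter_Iic n x)
  have hΩ₁ (x : Fin (n + 1) → ℝ) : qfun Ω 1 x =
      max (min 2 (x 0) - 1) 0 * ∏ j : Fin n, max (min 1 (x j.succ)) 0 :=
    (hq 1 x).trans (vol_cubeRight_inter_Iic n x)
  rw [meanL2sq_eq (K := boxI (n + 1)) measurableSet_Icc isCompact_Icc.measure_ne_top Ω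
    (by simp [hvol]) (by simp [hvol])]
  · have hint {f : (Fin (n + 1) → ℝ) → ℝ} (hf : Continuous f) :
        Integrable f (volume.restrict (boxI (n + 1))) :=
      hf.continuousOn.integrableOn_compact isCompact_Icc
    simp only [Fin.sum_univ_two, hΩ₀, hΩ₁]
    rw [integral_add (hint (by fun_prop)) (hint (by fun_prop)),
      setIntegral_boxI_mul_one_sub n (f := fun t => max (min 1 t) 0) (by fun_prop),
      setIntegral_boxI_mul_one_sub n (f := fun t => max (min 2 t - 1) 0) (by fun_prop),
      setIntegral_clamp_left_pow, setIntegral_clamp_left_pow,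
      setIntegral_clamp_right_pow one_ne_zero, setIntegral_clamp_right_pow two_ne_zero, vol_boxI]
    simp only [Fintype.card_fin, Nat.succ_eq_add_one, pow_succ, div_pow, one_pow]
    push_cast
    field_simp
    ring
  · intro x
    simp only [Fin.sum_univ_two, hΩ₀, hΩ₁, vol_boxI_inter_Iic, vol_boxI, ← add_mul,
      clamp_add_clamp]
    simp

end StratifiedSampling
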